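/- arXiv:1510.00722 — 2 statements merged into one kernel-verified Lean document; each statement's English description precedes it below -/
import Mathlib

section
/- If Γ ⊂ ℤ^n is an almost periodic pattern with D(Γ) > 0, then the frequency-of-differences function ρ_Γ : ℤ^n → [0,1], ρ_Γ(v) = D(Γ ∩ (Γ − v))/D(Γ), is Bohr almost periodic: for every ε > 0, the set {v ∈ ℤ^n : sup_{u∈ℤ^n} |ρ_Γ(u) − ρ_Γ(u+v)| < ε} is relatively dense in ℝ^n. -/
open Filter MeasureTheory
open scoped BigOperators

noncomputable section

/-- The projection `p : ℝ → ℤ`: the unique `k` with `k - 1/2 < x ≤ k + 1/2`. -/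
def roundHalf (x : ℝ) : ℤ := ⌈x - 1/2⌉

/-- Coercion of an integer vector to a real vector. -/
def intVec {n : ℕ} (v : Fin n → ℤ) : Fin n → ℝ := fun i => (v i : ℝ)

/-- The set of integer points of `ℝ^n`. -/
def intPoints (n : ℕ) : Set (Fin n → ℝ) := Set.range (intVec (n := n))

/-- The coordinatewise projection `π : ℝ^n → ℤ^n`. -/
def discretize {n : ℕ} (x : Fin n → ℝ) : Fin n → ℤ := fun i => roundHalf (x i)

/-- `π` viewed as a self-map of `ℝ^n`. -/
def discretizeR {n : ℕ} (x : Fin n → ℝ) : Fin n → ℝ := intVec (discretize x)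

/-- The image of a set `Γ` under the discretization `P̂` of the matrix `P`. -/
def PhatImg {n : ℕ} (P : Matrix (Fin n) (Fin n) ℝ) (Γ : Set (Fin n → ℝ)) :
    Set (Fin n → ℝ) :=
  (fun x => discretizeR (P.mulVec x)) '' Γ

/-- The uniform `R`-density `D_R^+`. Balls are sup-norm balls. -/
def DRplus {n : ℕ} (Γ : Set (Fin n → ℝ)) (R : ℝ) : ℝ :=
  ⨆ x : Fin n → ℝ,
    ((Metric.ball x R ∩ Γ).ncard : ℝ) / ((Metric.ball x R ∩ intPoints n).ncard : ℝ)

/-- Relatively dense with parameter `R₀`. -/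
def RelativelyDenseWith {n : ℕ} (Γ : Set (Fin n → ℝ)) (R₀ : ℝ) : Prop :=
  ∀ x : Fin n → ℝ, ∀ r, R₀ ≤ r → (Metric.ball x r ∩ Γ).Nonempty

def RelativelyDense {n : ℕ} (Γ : Set (Fin n → ℝ)) : Prop :=
  ∃ R₀ > 0, RelativelyDenseWith Γ R₀

/-- Uniformly discrete with parameter `r₀`. -/
def UniformlyDiscreteWith {n : ℕ} (Γ : Set (Fin n → ℝ)) (r₀ : ℝ) : Prop :=
  ∀ x : Fin n → ℝ, ∀ r, 0 < r → r ≤ r₀ → (Metric.ball x r ∩ Γ).Subsingleton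

def UniformlyDiscrete {n : ℕ} (Γ : Set (Fin n → ℝ)) : Prop :=
  ∃ r₀ > 0, UniformlyDiscreteWith Γ r₀

def Delone {n : ℕ} (Γ : Set (Fin n → ℝ)) : Prop :=
  RelativelyDense Γ ∧ UniformlyDiscrete Γ

/-- The translateSet `Γ + v`. -/
def translateSet {n : ℕ} (Γ : Set (Fin n → ℝ)) (v : Fin n → ℝ) : Set (Fin n → ℝ) :=
  (· + v) '' Γ

/-- `N` is a set of `ε`-translations of `Γ` with radius `Rε`. -/
def IsEpsTranslationSet {n : ℕ} (Γ : Set (Fin n → ℝ)) (ε Rε : ℝ)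
    (N : Set (Fin n → ℝ)) : Prop :=
  N ⊆ intPoints n ∧ RelativelyDense N ∧
    ∀ R, Rε ≤ R → ∀ v ∈ N, DRplus (symmDiff (translateSet Γ v) Γ) R < ε

/-- Almost periodic pattern. -/
def AlmostPeriodicPattern {n : ℕ} (Γ : Set (Fin n → ℝ)) : Prop :=
  Γ ⊆ intPoints n ∧ Delone Γ ∧
    ∀ ε > 0, ∃ Rε > 0, ∃ N : Set (Fin n → ℝ), IsEpsTranslationSet Γ ε Rε N

/-- `Γ` has uniform density `D`. -/
def HasUnifDensity {n : ℕ} (Γ : Set (Fin n → ℝ)) (D : ℝ) : Prop :=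
  ∀ ε > 0, ∃ R₀ > 0, ∀ R, R₀ ≤ R → ∀ x : Fin n → ℝ,
    |((Metric.ball x R ∩ Γ).ncard : ℝ) / ((Metric.ball x R ∩ intPoints n).ncard : ℝ) - D| ≤ ε

/-- `Γ ∩ (Γ - v)`, the set of `x ∈ Γ` with `x + v ∈ Γ`. -/
def diffSet {n : ℕ} (Γ : Set (Fin n → ℝ)) (v : Fin n → ℝ) : Set (Fin n → ℝ) :=
  Γ ∩ {x | x + v ∈ Γ}

/-- `E` is equidistributed modulo `ℤ^n`: averages of continuous `ℤ^n`-periodic functions over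
`E ∩ B_R` converge to the Haar integral. -/
def EquidistributedModZn {n : ℕ} (E : Set (Fin n → ℝ)) : Prop :=
  ∀ f : (Fin n → ℝ) → ℝ, Continuous f →
    (∀ (x : Fin n → ℝ) (v : Fin n → ℤ), f (x + intVec v) = f x) →
    Filter.Tendsto (fun R : ℝ =>
        (∑ᶠ x ∈ E ∩ Metric.ball (0 : Fin n → ℝ) R, f x) /
          ((E ∩ Metric.ball (0 : Fin n → ℝ) R).ncard : ℝ))
      Filter.atTop
      (nhds (∫ x in Set.pi Set.univ (fun _ : Fin n => Set.Ico (0:ℝ) 1), f x))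

/-- `P` is totally irrational: `P(ℤ^n)` is equidistributed modulo `ℤ^n`. -/
def TotallyIrrational {n : ℕ} (P : Matrix (Fin n) (Fin n) ℝ) : Prop :=
  EquidistributedModZn (P.mulVec '' intPoints n)

/-- Rate of injectivity in time 1. -/
def tauOne {n : ℕ} (P : Matrix (Fin n) (Fin n) ℝ) : ℝ :=
  Filter.limsup (fun R : ℝ =>
    ((PhatImg P (intPoints n) ∩ Metric.ball (0 : Fin n → ℝ) R).ncard : ℝ) /
      ((intPoints n ∩ Metric.ball (0 : Fin n → ℝ) R).ncard : ℝ)) Filter.atTop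

/-- The successive images `(P̂_k ∘ ⋯ ∘ P̂_1)(Γ)`. -/
def seqImg {n : ℕ} (P : ℕ → Matrix (Fin n) (Fin n) ℝ) :
    ℕ → Set (Fin n → ℝ) → Set (Fin n → ℝ)
  | 0, Γ => Γ
  | k + 1, Γ => PhatImg (P (k + 1)) (seqImg P k Γ)

/-- Rate of injectivity in time `k` of the sequence `(P_k)`. -/
def tauK {n : ℕ} (P : ℕ → Matrix (Fin n) (Fin n) ℝ) (k : ℕ) : ℝ :=
  Filter.limsup (fun R : ℝ =>
    ((seqImg P k (intPoints n) ∩ Metric.ball (0 : Fin n → ℝ) R).ncard : ℝ) /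
      ((intPoints n ∩ Metric.ball (0 : Fin n → ℝ) R).ncard : ℝ)) Filter.atTop

/-- A fixed norm on `M_n(ℝ)`: the sup of absolute values of the entries. -/
def matNorm {n : ℕ} (A : Matrix (Fin n) (Fin n) ℝ) : ℝ :=
  ⨆ p : Fin n × Fin n, |A p.1 p.2|


/-- The function `φ_u`, a "weighted projection" of `u` on `ℤ^n`. -/
def phiFn {n : ℕ} (u : Fin n → ℝ) (v : Fin n → ℤ) : ℝ :=
  if ‖u - intVec v‖ < 1 then ∏ i, (1 - |u i - (v i : ℝ)|) else 0

/-- `I_ℚ(A)`: the set of indices `i` such that all entries of the `i`-th row of `A`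
are rational. -/
def IQ {n : ℕ} (A : Matrix (Fin n) (Fin n) ℝ) : Set (Fin n) :=
  {i | ∀ j, ∃ q : ℚ, A i j = (q : ℝ)}

/-- A sequence of matrices all lying in `O_n(ℝ)`. -/
def IsOnSeq {n : ℕ} (P : ℕ → Matrix (Fin n) (Fin n) ℝ) : Prop :=
  ∀ k, P k ∈ Matrix.orthogonalGroup (Fin n) ℝ

/-- The `ℓ^∞` distance on sequences of matrices. -/
def seqDist {n : ℕ} (P Q : ℕ → Matrix (Fin n) (Fin n) ℝ) : ℝ :=
  ⨆ k : ℕ, matNorm (P k - Q k)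

/-- Open subsets of `ℓ^∞(O_n(ℝ))`. -/
def IsOpenSeq {n : ℕ} (U : Set {P : ℕ → Matrix (Fin n) (Fin n) ℝ // IsOnSeq P}) : Prop :=
  ∀ P ∈ U, ∃ δ > 0, ∀ Q : {P : ℕ → Matrix (Fin n) (Fin n) ℝ // IsOnSeq P},
    seqDist P.1 Q.1 < δ → Q ∈ U

/-- Dense subsets of `ℓ^∞(O_n(ℝ))`. -/
def IsDenseSeq {n : ℕ} (U : Set {P : ℕ → Matrix (Fin n) (Fin n) ℝ // IsOnSeq P}) : Prop :=
  ∀ P : {P : ℕ → Matrix (Fin n) (Fin n) ℝ // IsOnSeq P}, ∀ δ > 0,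
    ∃ Q ∈ U, seqDist P.1 Q.1 < δ

theorem finite_ball_inter_intPoints {n : ℕ} (x : Fin n → ℝ) (R : ℝ) :
    (Metric.ball x R ∩ intPoints n).Finite := by
  refine ((Set.finite_Icc (fun i => ⌊x i - R⌋) (fun i => ⌈x i + R⌉)).image
    (intVec (n := n))).subset ?_
  rintro _ ⟨hy, v, rfl⟩
  have h (i : Fin n) : |(v i : ℝ) - x i| < R :=
    lt_of_le_of_lt (dist_le_pi_dist (intVec v) x i) hy
  refine ⟨v, ⟨fun i => ?_, fun i => ?_⟩, rfl⟩
  · have := (abs_lt.1 (h i)).1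
    exact Int.cast_le.1 ((Int.floor_le (x i - R)).trans (by linarith : _ ≤ (v i : ℝ)))
  · have := (abs_lt.1 (h i)).2
    exact Int.cast_le.1 ((by linarith : (v i : ℝ) ≤ x i + R).trans (Int.le_ceil (x i + R)))

theorem intVec_add {n : ℕ} (u v : Fin n → ℤ) : intVec (u + v) = intVec u + intVec v := by
  ext i
  simp [intVec]

theorem add_intVec_mem_intPoints_iff {n : ℕ} (x : Fin n → ℝ) (w : Fin n → ℤ) :
    x + intVec w ∈ intPoints n ↔ x ∈ intPoints n := by
  constructor
  · rintro ⟨z, hz⟩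
    refine ⟨z - w, ?_⟩
    have := intVec_add (z - w) w
    rw [sub_add_cancel, hz] at this
    exact (add_right_cancel this).symm
  · rintro ⟨z, rfl⟩
    exact ⟨z + w, intVec_add z w⟩

theorem add_right_mem_ball_add_right_iff {n : ℕ} (x c w : Fin n → ℝ) (R : ℝ) :
    x + w ∈ Metric.ball (c + w) R ↔ x ∈ Metric.ball c R := by
  simp [Metric.mem_ball]

theorem ncard_ball_add_intVec_inter_intPoints {n : ℕ} (c : Fin n → ℝ) (w : Fin n → ℤ) (R : ℝ) :
    (Metric.ball (c + intVec w) R ∩ intPoints n).ncard =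
      (Metric.ball c R ∩ intPoints n).ncard := by
  rw [← Set.ncard_image_of_injective (Metric.ball c R ∩ intPoints n)
    (add_left_injective (intVec w))]
  congr 1
  ext y
  constructor
  · rintro ⟨hy, hy'⟩
    obtain ⟨x, rfl⟩ : ∃ x, x + intVec w = y := ⟨y - intVec w, sub_add_cancel _ _⟩
    exact ⟨x, ⟨(add_right_mem_ball_add_right_iff ..).1 hy, (add_intVec_mem_intPoints_iff ..).1 hy'⟩, rfl⟩
  · rintro ⟨x, ⟨hx, hx'⟩, rfl⟩
    exact ⟨(add_right_mem_ball_add_right_iff ..).2 hx, (add_intVec_mem_intPoints_iff ..).2 hx'⟩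

theorem ncard_div_le_DRplus {n : ℕ} {S : Set (Fin n → ℝ)} (hS : S ⊆ intPoints n)
    (x : Fin n → ℝ) (R : ℝ) :
    ((Metric.ball x R ∩ S).ncard : ℝ) / ((Metric.ball x R ∩ intPoints n).ncard : ℝ) ≤
      DRplus S R := by
  refine le_ciSup (f := fun x : Fin n → ℝ =>
    ((Metric.ball x R ∩ S).ncard : ℝ) / ((Metric.ball x R ∩ intPoints n).ncard : ℝ)) ⟨1, ?_⟩ x
  rintro _ ⟨y, rfl⟩
  refine div_le_one_of_le₀ ?_ (Nat.cast_nonneg _)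
  exact_mod_cast Set.ncard_le_ncard (Set.inter_subset_inter_right _ hS)
    (finite_ball_inter_intPoints y R)

theorem symmDiff_translateSet_subset_intPoints {n : ℕ} {Γ : Set (Fin n → ℝ)}
    (hΓ : Γ ⊆ intPoints n) (v : Fin n → ℤ) :
    symmDiff (translateSet Γ (intVec v)) Γ ⊆ intPoints n := by
  rintro _ (⟨⟨x, hx, rfl⟩, -⟩ | ⟨hx, -⟩)
  · exact (add_intVec_mem_intPoints_iff x v).2 (hΓ hx)
  · exact hΓ hx

theorem add_mem_translateSet_iff {n : ℕ} {Γ : Set (Fin n → ℝ)} (x v : Fin n → ℝ) :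
    x + v ∈ translateSet Γ v ↔ x ∈ Γ := by
  simp [translateSet]

theorem add_mem_symmDiff_of_mem_symmDiff_diffSet {n : ℕ} {Γ : Set (Fin n → ℝ)}
    {u v : Fin n → ℤ} {x : Fin n → ℝ}
    (hx : x ∈ symmDiff (diffSet Γ (intVec u)) (diffSet Γ (intVec (u + v)))) :
    x + intVec (u + v) ∈ symmDiff (translateSet Γ (intVec v)) Γ := by
  have h := add_mem_translateSet_iff (Γ := Γ) (x + intVec u) (intVec v)
  simp only [Set.mem_symmDiff, diffSet, Set.mem_inter_iff, Set.mem_ofPred_eq, intVec_add,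
    ← add_assoc] at hx h ⊢
  tauto

theorem abs_ncard_sub_ncard_le_ncard_symmDiff {α : Type*} {s t : Set α} (hs : s.Finite)
    (ht : t.Finite) : |(s.ncard : ℝ) - t.ncard| ≤ (symmDiff s t).ncard := by
  have hst : (symmDiff s t).Finite := (hs.union ht).subset symmDiff_le_sup
  have h₁ : s.ncard ≤ (symmDiff s t).ncard + t.ncard :=
    (Set.ncard_le_ncard (fun x hx => by by_cases x ∈ t <;> simp_all [Set.mem_symmDiff])
      (hst.union ht)).trans (Set.ncard_union_le _ _)
  have h₂ : t.ncard ≤ (symmDiff s t).ncard + s.ncard :=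
    (Set.ncard_le_ncard (fun x hx => by by_cases x ∈ s <;> simp_all [Set.mem_symmDiff])
      (hst.union hs)).trans (Set.ncard_union_le _ _)
  rify at h₁ h₂
  exact abs_le.2 ⟨by linarith, by linarith⟩

/-- Translating the difference vector by `v` changes the proportion of points of `diffSet` in a
ball by at most the uniform density of `(Γ + v) Δ Γ`. -/
theorem abs_ncard_diffSet_div_sub_le_DRplus {n : ℕ} {Γ : Set (Fin n → ℝ)}
    (hΓ : Γ ⊆ intPoints n) (u v : Fin n → ℤ) (c : Fin n → ℝ) (R : ℝ) :
    |((Metric.ball c R ∩ diffSet Γ (intVec u)).ncard : ℝ) /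
        ((Metric.ball c R ∩ intPoints n).ncard : ℝ) -
      ((Metric.ball c R ∩ diffSet Γ (intVec (u + v))).ncard : ℝ) /
        ((Metric.ball c R ∩ intPoints n).ncard : ℝ)| ≤
      DRplus (symmDiff (translateSet Γ (intVec v)) Γ) R := by
  have hS := symmDiff_translateSet_subset_intPoints hΓ v
  have hfin (w : Fin n → ℤ) : (Metric.ball c R ∩ diffSet Γ (intVec w)).Finite :=
    (finite_ball_inter_intPoints c R).subset
      (Set.inter_subset_inter_right _ (Set.inter_subset_left.trans hΓ))
  refine le_trans ?_ (ncard_div_le_DRplus hS (c + intVec (u + v)) R)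
  rw [ncard_ball_add_intVec_inter_intPoints, ← sub_div, abs_div, Nat.abs_cast]
  gcongr
  refine (abs_ncard_sub_ncard_le_ncard_symmDiff (hfin u) (hfin (u + v))).trans ?_
  norm_cast
  refine Set.ncard_le_ncard_of_injOn (· + intVec (u + v)) ?_ (add_left_injective _).injOn
    ((finite_ball_inter_intPoints _ R).subset (Set.inter_subset_inter_right _ hS))
  intro x hx
  rw [← Set.inter_symmDiff_distrib_left] at hx
  exact ⟨(add_right_mem_ball_add_right_iff ..).2 hx.1, add_mem_symmDiff_of_mem_symmDiff_diffSet hx.2⟩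

theorem RelativelyDense.mono {n : ℕ} {A B : Set (Fin n → ℝ)} (hA : RelativelyDense A)
    (hAB : A ⊆ B) : RelativelyDense B := by
  obtain ⟨R, hR, h⟩ := hA
  exact ⟨R, hR, fun x r hr => (h x r hr).mono (Set.inter_subset_inter_right _ hAB)⟩

/-- If `Γ` is an almost periodic pattern with positive uniform density, the frequency of
differences function `ρ_Γ` is Bohr almost periodic: for every `ε > 0`, the set of `v ∈ ℤ^n`
with `sup_u |ρ_Γ(u) - ρ_Γ(u+v)| < ε` is relatively dense. -/
theorem statement3 {n : ℕ} (Γ : Set (Fin n → ℝ)) (hΓ : AlmostPeriodicPattern Γ)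
    (D : ℝ) (hD : HasUnifDensity Γ D) (hDpos : 0 < D)
    (ρ : (Fin n → ℤ) → ℝ) (hρ01 : ∀ v, ρ v ∈ Set.Icc (0 : ℝ) 1)
    (hρ : ∀ v : Fin n → ℤ, HasUnifDensity (diffSet Γ (intVec v)) (ρ v * D)) :
    ∀ ε > 0, RelativelyDense
      (intVec '' {v : Fin n → ℤ | (⨆ u : Fin n → ℤ, |ρ u - ρ (u + v)|) < ε}) := by
  intro ε hε
  obtain ⟨hsub, -, hap⟩ := hΓ
  obtain ⟨R₁, -, N, hN, hNdense, hNtrans⟩ := hap (ε / 2 * D) (by positivity)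
  refine hNdense.mono fun w hw => ?_
  obtain ⟨v, rfl⟩ := hN hw
  refine ⟨v, ?_, rfl⟩
  refine lt_of_le_of_lt (ciSup_le fun u => ?_) (half_lt_self hε)
  refine le_of_mul_le_mul_right (le_of_forall_pos_le_add fun η hη => ?_) hDpos
  obtain ⟨R₂, -, h₂⟩ := hρ u (η / 2) (by positivity)
  obtain ⟨R₃, -, h₃⟩ := hρ (u + v) (η / 2) (by positivity)
  set R := max R₁ (max R₂ R₃)
  have k₁ := hNtrans R (le_max_left _ _) _ hw
  have k₂ := h₂ R ((le_max_left _ _).trans (le_max_right _ _)) 0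
  have k₃ := h₃ R ((le_max_right _ _).trans (le_max_right _ _)) 0
  have k₄ := abs_ncard_diffSet_div_sub_le_DRplus hsub u v 0 R
  rw [← abs_of_pos hDpos, ← abs_mul, abs_of_pos hDpos, sub_mul]
  rw [abs_le] at k₂ k₃ k₄ ⊢
  constructor <;> linarith

end
end

section
/- Let P ∈ O_n(ℝ) be totally irrational, Λ = P(ℤ^n), and U = ⋃_{λ∈Λ} B(λ,1/2) the union of the open sup-norm balls of radius 1/2 centred at the points of Λ. Then the rate of injectivity in time 1 satisfies τ^1(P) = Leb(U ∩ 𝒟) for any fundamental domain 𝒟 of the lattice Λ in ℝ^n. -/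
open Filter MeasureTheory
open scoped BigOperators

noncomputable section

theorem norm_sum_zpow_Icc_le {w : ℂ} (hw : ‖w‖ = 1) (hw1 : w ≠ 1) (N : ℕ) :
    ‖∑ y ∈ Finset.Icc (-(N : ℤ)) N, w ^ y‖ ≤ 2 / ‖w - 1‖ := by
  have hw0 : w ≠ 0 := by rintro rfl; simp at hw
  have key : ∀ N : ℕ, (∑ y ∈ Finset.Icc (-(N : ℤ)) N, w ^ y) * (w - 1) =
      w ^ ((N : ℤ) + 1) - w ^ (-(N : ℤ)) := by
    intro N
    induction N with
    | zero => simp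
    | succ N ih =>
      have hI : Finset.Icc (-((N + 1 : ℕ) : ℤ)) ((N + 1 : ℕ) : ℤ) =
          insert (-(N : ℤ) - 1) (insert ((N : ℤ) + 1) (Finset.Icc (-(N : ℤ)) N)) := by
        ext y
        simp only [Finset.mem_Icc, Finset.mem_insert]
        omega
      rw [hI, Finset.sum_insert (by simp only [Finset.mem_Icc, Finset.mem_insert]; omega),
        Finset.sum_insert (by simp only [Finset.mem_Icc]; omega), add_mul, add_mul, ih]
      have h1 : w ^ (((N + 1 : ℕ) : ℤ) + 1) = w ^ ((N : ℤ) + 1) * w := by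
        push_cast; rw [zpow_add_one₀ hw0]
      have h2 : w ^ (-(N : ℤ)) = w ^ (-(N : ℤ) - 1) * w := by
        rw [← zpow_add_one₀ hw0]; congr 1; ring
      have h3 : -((N + 1 : ℕ) : ℤ) = -(N : ℤ) - 1 := by push_cast; ring
      rw [h1, h2, h3]
      ring
  rw [le_div_iff₀ (norm_pos_iff.2 (sub_ne_zero.2 hw1)), ← norm_mul, key]
  refine (norm_sub_le _ _).trans ?_
  rw [norm_zpow, norm_zpow, hw]
  norm_num

/-- The integer points of the closed sup-norm ball of radius `N`. -/
def intBox (n N : ℕ) : Finset (Fin n → ℤ) :=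
  Fintype.piFinset fun _ => Finset.Icc (-(N : ℤ)) N

theorem card_intBox (n N : ℕ) : (intBox n N).card = (2 * N + 1) ^ n := by
  simp only [intBox, Fintype.card_piFinset, Int.card_Icc, Finset.prod_const, Finset.card_univ,
    Fintype.card_fin]
  congr 1
  omega

theorem intBox_nonempty (n N : ℕ) : (intBox n N).Nonempty := by
  rw [← Finset.card_pos, card_intBox]
  positivity

/-- The projection `ℝ^n → ℝ^n/ℤ^n`. -/
def torusMk {n : ℕ} (x : Fin n → ℝ) : UnitAddTorus (Fin n) := fun i => (x i : UnitAddCircle)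

theorem torusMk_eq_torusMk_iff {n : ℕ} {x y : Fin n → ℝ} :
    torusMk x = torusMk y ↔ ∃ m : Fin n → ℤ, x = y + intVec m := by
  have h : ∀ a b : ℝ, ((a : UnitAddCircle) = b) ↔ ∃ m : ℤ, a = b + m := by
    intro a b
    rw [← sub_eq_zero, ← AddCircle.coe_sub, AddCircle.coe_eq_zero_iff]
    exact exists_congr fun m => by
      rw [zsmul_eq_mul, mul_one, eq_comm, sub_eq_iff_eq_add']
  simp only [torusMk, funext_iff, h, Classical.skolem, intVec, Pi.add_apply]

theorem continuous_torusMk {n : ℕ} : Continuous (torusMk (n := n)) := by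
  unfold torusMk
  fun_prop

theorem isOpenMap_torusMk {n : ℕ} : IsOpenMap (torusMk (n := n)) :=
  IsOpenMap.piMap (fun _ => QuotientAddGroup.isOpenMap_coe)
    (Filter.Eventually.of_forall fun _ => QuotientAddGroup.mk_surjective)

theorem mFourier_torusMk {n : ℕ} (k : Fin n → ℤ) (x : Fin n → ℝ) :
    UnitAddTorus.mFourier k (torusMk x) =
      Complex.exp (2 * Real.pi * Complex.I * ((intVec k ⬝ᵥ x : ℝ) : ℂ)) := by
  simp only [UnitAddTorus.mFourier, torusMk, ContinuousMap.coe_mk, fourier_coe_apply, dotProduct,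
    intVec, ← Complex.exp_sum, Complex.ofReal_sum, Finset.mul_sum]
  congr 1
  refine Finset.sum_congr rfl fun i _ => ?_
  push_cast
  ring

/-- The unit cube `[0,1)^n`. -/
def unitCube (n : ℕ) : Set (Fin n → ℝ) := Set.pi Set.univ fun _ : Fin n => Set.Ico (0 : ℝ) 1

theorem integral_mFourier_unitCube {n : ℕ} {k : Fin n → ℤ} (hk : k ≠ 0) :
    ∫ x in unitCube n, UnitAddTorus.mFourier k (torusMk x) = 0 := by
  obtain ⟨i, hi⟩ := Function.ne_iff.1 hk
  rw [unitCube, volume_pi, Measure.restrict_pi_pi]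
  simp only [UnitAddTorus.mFourier, torusMk, ContinuousMap.coe_mk]
  rw [integral_fintype_prod_eq_prod (fun i (t : ℝ) => (fourier (k i) (t : UnitAddCircle) : ℂ))]
  refine Finset.prod_eq_zero (Finset.mem_univ i) ?_
  rw [integral_Ico_eq_integral_Ioc, ← intervalIntegral.integral_of_le zero_le_one]
  have hc : (2 * Real.pi * Complex.I * (k i : ℂ)) ≠ 0 := by
    simp [Real.pi_ne_zero]
    simpa using hi
  have := integral_exp_mul_complex (a := 0) (b := 1) hc
  simp only [fourier_coe_apply, Complex.ofReal_one, div_one]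
  rw [this, sub_eq_zero.2, zero_div]
  have h1 : 2 * Real.pi * Complex.I * (k i : ℂ) * ((1 : ℝ) : ℂ) =
    (k i : ℂ) * (2 * Real.pi * Complex.I) := by push_cast; ring
  rw [h1, Complex.exp_int_mul_two_pi_mul_I]
  simp

theorem tendsto_of_tendsto_integral_mFourier {d ι : Type*} [Fintype d] {L : Filter ι}
    {μs : ι → ProbabilityMeasure (UnitAddTorus d)} {μ : ProbabilityMeasure (UnitAddTorus d)}
    (h : ∀ k, Tendsto (fun i => ∫ x, UnitAddTorus.mFourier k x ∂(μs i : Measure (UnitAddTorus d))) L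
      (nhds (∫ x, UnitAddTorus.mFourier k x ∂(μ : Measure (UnitAddTorus d))))) :
    Tendsto μs L (nhds μ) := by
  have h_int : ∀ (ν : ProbabilityMeasure (UnitAddTorus d)) (f : C(UnitAddTorus d, ℂ)),
      Integrable f (ν : Measure (UnitAddTorus d)) := fun ν f =>
    (BoundedContinuousFunction.mkOfCompact f).integrable _
  refine ProbabilityMeasure.tendsto_of_tight_of_separatesPoints ℂ IsTightMeasureSet.of_compactSpace
    (A := (UnitAddTorus.mFourierSubalgebra d).comap
      (BoundedContinuousFunction.toContinuousMapStarₐ ℂ)) ?_ ?_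
  · intro x y hxy
    obtain ⟨_, ⟨f, hf, rfl⟩, hfxy⟩ := UnitAddTorus.mFourierSubalgebra_separatesPoints hxy
    exact ⟨f, ⟨f, ⟨BoundedContinuousFunction.mkOfCompact f, hf, rfl⟩, rfl⟩, hfxy⟩
  · intro g hg
    have hg' : (g : C(UnitAddTorus d, ℂ)) ∈
        Submodule.span ℂ (Set.range (UnitAddTorus.mFourier (d := d))) := by
      rw [← UnitAddTorus.mFourierSubalgebra_coe]
      exact hg
    suffices H : ∀ f ∈ Submodule.span ℂ (Set.range (UnitAddTorus.mFourier (d := d))),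
        Tendsto (fun i => ∫ x, f x ∂(μs i : Measure (UnitAddTorus d))) L
          (nhds (∫ x, f x ∂(μ : Measure (UnitAddTorus d)))) from H _ hg'
    intro f hf
    induction hf using Submodule.span_induction with
    | mem f hf => obtain ⟨k, rfl⟩ := hf; exact h k
    | zero => simpa using tendsto_const_nhds
    | add f g _ _ hf hg =>
      simp only [ContinuousMap.add_apply]
      simp_rw [fun ν => integral_add (h_int ν f) (h_int ν g)]
      exact hf.add hg
    | smul c f _ hf =>
      simp only [ContinuousMap.smul_apply, integral_smul]
      exact hf.const_smul c

theorem torusMk_add_intVec {n : ℕ} (x : Fin n → ℝ) (m : Fin n → ℤ) :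
    torusMk (x + intVec m) = torusMk x :=
  torusMk_eq_torusMk_iff.2 ⟨m, rfl⟩

theorem mFourier_torusMk_transpose_mulVec {n : ℕ} (P : Matrix (Fin n) (Fin n) ℝ) (k : Fin n → ℤ)
    (x : Fin n → ℝ) :
    UnitAddTorus.mFourier k (torusMk (P.transpose.mulVec x)) =
      Complex.exp (2 * Real.pi * Complex.I * ((P.mulVec (intVec k) ⬝ᵥ x : ℝ) : ℂ)) := by
  rw [mFourier_torusMk, Matrix.dotProduct_mulVec, Matrix.vecMul_transpose]

theorem volume_unitCube (n : ℕ) : volume (unitCube n) = 1 := by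
  simp [unitCube, volume_pi_pi]

theorem measurableSet_unitCube (n : ℕ) : MeasurableSet (unitCube n) :=
  MeasurableSet.univ_pi fun _ => measurableSet_Ico

theorem exists_mulVec_intVec_ne_intCast {n : ℕ} {P : Matrix (Fin n) (Fin n) ℝ}
    (hP : P ∈ Matrix.orthogonalGroup (Fin n) ℝ) (hirr : TotallyIrrational P)
    {k : Fin n → ℤ} (hk : k ≠ 0) : ∃ j, ∀ m : ℤ, P.mulVec (intVec k) j ≠ m := by
  by_contra! hcon
  choose m hm using hcon
  have hm' : P.mulVec (intVec k) = intVec m := funext hm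
  have hPP : P.transpose * P = 1 := (Matrix.mem_orthogonalGroup_iff' _ _).1 hP
  have hkm : P.transpose.mulVec (intVec m) = intVec k := by
    rw [← hm', Matrix.mulVec_mulVec, hPP, Matrix.one_mulVec]
  have hm0 : m ≠ 0 := by
    rintro rfl
    apply hk
    have h0 : intVec (0 : Fin n → ℤ) = 0 := by ext; simp [intVec]
    rw [h0, Matrix.mulVec_zero] at hkm
    ext i
    have := congrFun hkm i
    simp only [intVec, Pi.zero_apply] at this ⊢
    exact_mod_cast this.symm
  set f : (Fin n → ℝ) → ℝ := fun x => (UnitAddTorus.mFourier m (torusMk x)).re with hf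
  have hf1 : ∀ x ∈ P.mulVec '' intPoints n, f x = 1 := by
    rintro _ ⟨_, ⟨z, rfl⟩, rfl⟩
    have := mFourier_torusMk_transpose_mulVec P.transpose m (intVec z)
    rw [Matrix.transpose_transpose, hkm] at this
    simp only [hf, this]
    have hz : ((intVec k ⬝ᵥ intVec z : ℝ) : ℂ) = ((k ⬝ᵥ z : ℤ) : ℂ) := by
      simp [dotProduct, intVec]
    rw [hz, mul_comm, Complex.exp_int_mul_two_pi_mul_I, Complex.one_re]
  have h1 := hirr f (Complex.continuous_re.comp
    ((UnitAddTorus.mFourier m).continuous.comp continuous_torusMk))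
    (fun x v => by simp only [hf, torusMk_add_intVec])
  have h2 := hirr (fun _ => 1) continuous_const (fun _ _ => rfl)
  have h3 : ∀ R : ℝ, (∑ᶠ x ∈ P.mulVec '' intPoints n ∩ Metric.ball (0 : Fin n → ℝ) R, f x) =
      ∑ᶠ x ∈ P.mulVec '' intPoints n ∩ Metric.ball (0 : Fin n → ℝ) R, (1 : ℝ) :=
    fun R => finsum_mem_congr rfl fun x hx => hf1 x hx.1
  simp only [h3] at h1
  have h4 := tendsto_nhds_unique h1 h2
  have h5 : ∫ x in unitCube n, f x = 0 := by
    have h_int : Integrable (fun x => UnitAddTorus.mFourier m (torusMk x))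
        (volume.restrict (unitCube n)) := by
      have : IsFiniteMeasure (volume.restrict (unitCube n)) :=
        ⟨by simp [volume_unitCube]⟩
      refine Integrable.of_bound ((UnitAddTorus.mFourier m).continuous.comp
        continuous_torusMk).aestronglyMeasurable 1 (Eventually.of_forall fun x => ?_)
      exact ((UnitAddTorus.mFourier m).norm_coe_le_norm _).trans_eq UnitAddTorus.mFourier_norm
    have := integral_re h_int
    rw [integral_mFourier_unitCube hm0] at this
    simpa using this
  have h6 : ∫ x in unitCube n, (1 : ℝ) = 1 := by simp [measureReal_def, volume_unitCube]
  exact zero_ne_one (h5.symm.trans (h4.trans h6))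

theorem tendsto_average_exp {n : ℕ} {α : Fin n → ℝ} (hα : ∃ j, ∀ m : ℤ, α j ≠ m) :
    Tendsto (fun N : ℕ => ((intBox n N).card : ℝ)⁻¹ • ∑ y ∈ intBox n N,
      Complex.exp (2 * Real.pi * Complex.I * ((α ⬝ᵥ intVec y : ℝ) : ℂ))) atTop (nhds 0) := by
  obtain ⟨j, hj⟩ := hα
  set w : Fin n → ℂ := fun i => Complex.exp ((2 * Real.pi * α i : ℝ) * Complex.I) with hw
  have hw1 : ∀ i, ‖w i‖ = 1 := fun i => Complex.norm_exp_ofReal_mul_I _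
  have hwj : w j ≠ 1 := by
    intro h
    obtain ⟨m, hm⟩ := Complex.exp_eq_one_iff.1 h
    apply hj m
    have h2 : ((2 * Real.pi * α j : ℝ) : ℂ) * Complex.I = ((2 * Real.pi * m : ℝ) : ℂ) * Complex.I := by
      rw [hm]; push_cast; ring
    have h3 := Complex.ofReal_injective (mul_right_cancel₀ Complex.I_ne_zero h2)
    exact mul_left_cancel₀ (by positivity) h3
  have hsum : ∀ N : ℕ, ∑ y ∈ intBox n N,
      Complex.exp (2 * Real.pi * Complex.I * ((α ⬝ᵥ intVec y : ℝ) : ℂ)) =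
      ∏ i, ∑ t ∈ Finset.Icc (-(N : ℤ)) N, w i ^ t := by
    intro N
    rw [intBox, ← Finset.sum_prod_piFinset]
    refine Finset.sum_congr rfl fun y _ => ?_
    simp only [hw, ← Complex.exp_int_mul, ← Complex.exp_sum, dotProduct, intVec,
      Complex.ofReal_sum, Finset.mul_sum]
    congr 1
    refine Finset.sum_congr rfl fun i _ => ?_
    push_cast
    ring
  refine squeeze_zero_norm (a := fun N : ℕ => (2 / ‖w j - 1‖) / (2 * N + 1)) (fun N => ?_) ?_
  · have hN : (0 : ℝ) < 2 * N + 1 := by positivity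
    have h1 : ‖((intBox n N).card : ℝ)⁻¹ • ∏ i, ∑ t ∈ Finset.Icc (-(N : ℤ)) N, w i ^ t‖ =
        ∏ i, (‖∑ t ∈ Finset.Icc (-(N : ℤ)) N, w i ^ t‖ / (2 * N + 1)) := by
      rw [norm_smul, norm_prod, Finset.prod_div_distrib, Finset.prod_const, Finset.card_univ,
        Fintype.card_fin, card_intBox, div_eq_inv_mul]
      congr 1
      rw [Real.norm_of_nonneg (by positivity)]
      push_cast
      rfl
    rw [hsum, h1, ← Finset.mul_prod_erase _ _ (Finset.mem_univ j)]
    refine (mul_le_of_le_one_right (by positivity) (Finset.prod_le_one (fun i _ => by positivity)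
      fun i _ => ?_)).trans ?_
    · rw [div_le_one hN]
      refine (norm_sum_le _ _).trans ?_
      simp only [norm_zpow, hw1, one_zpow, Finset.sum_const, Int.card_Icc, nsmul_eq_mul, mul_one]
      have : ((N : ℤ) + 1 - -(N : ℤ)).toNat = 2 * N + 1 := by omega
      rw [this]
      push_cast
      rfl
    · gcongr
      exact norm_sum_zpow_Icc_le (hw1 j) hwj N
  · refine Tendsto.div_atTop tendsto_const_nhds ?_
    exact tendsto_atTop_add_const_right _ _
      (tendsto_natCast_atTop_atTop.const_mul_atTop two_pos)

/-- The uniform probability measure on the images under `g` of the points of `intBox n N`. -/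
def empiricalMeasure {n : ℕ} {T : Type*} [MeasurableSpace T] (g : (Fin n → ℤ) → T) (N : ℕ) :
    ProbabilityMeasure T :=
  ⟨((intBox n N).card : ENNReal)⁻¹ • ∑ y ∈ intBox n N, Measure.dirac (g y), ⟨by
    have : ((intBox n N).card : ENNReal) ≠ 0 := by
      exact_mod_cast (intBox_nonempty n N).card_ne_zero
    simp [ENNReal.inv_mul_cancel this]⟩⟩

theorem integral_empiricalMeasure {n : ℕ} {T E : Type*} [MeasurableSpace T]
    [MeasurableSingletonClass T] [NormedAddCommGroup E] [NormedSpace ℝ E] [CompleteSpace E]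
    (g : (Fin n → ℤ) → T) (N : ℕ) (f : T → E) :
    ∫ x, f x ∂(empiricalMeasure g N : Measure T) =
      ((intBox n N).card : ℝ)⁻¹ • ∑ y ∈ intBox n N, f (g y) := by
  simp only [empiricalMeasure, ProbabilityMeasure.coe_mk, integral_smul_measure]
  rw [integral_finsetSum_measure fun y _ => integrable_dirac (by simp)]
  simp

open Classical in
theorem empiricalMeasure_apply_toReal {n : ℕ} {T : Type*} [MeasurableSpace T]
    [MeasurableSingletonClass T] (g : (Fin n → ℤ) → T) (N : ℕ) (A : Set T) :
    ((empiricalMeasure g N : Measure T) A).toReal =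
      ((intBox n N).filter (fun y => g y ∈ A)).card / (intBox n N).card := by
  simp only [empiricalMeasure, ProbabilityMeasure.coe_mk, Measure.smul_apply, Measure.coe_finsetSum,
    Finset.sum_apply, Measure.dirac_apply, Set.indicator_apply, Pi.one_apply, Finset.sum_boole,
    smul_eq_mul, ENNReal.toReal_mul, ENNReal.toReal_inv, ENNReal.toReal_natCast]
  rw [div_eq_inv_mul]

/-- The uniform probability measure on the torus `ℝ^n/ℤ^n`. -/
def torusMeasure (n : ℕ) : ProbabilityMeasure (UnitAddTorus (Fin n)) :=
  ⟨(volume.restrict (unitCube n)).map torusMk, ⟨by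
    rw [Measure.map_apply continuous_torusMk.measurable MeasurableSet.univ]
    simp [volume_unitCube]⟩⟩

theorem integral_torusMeasure {n : ℕ} (f : C(UnitAddTorus (Fin n), ℂ)) :
    ∫ x, f x ∂(torusMeasure n : Measure (UnitAddTorus (Fin n))) =
      ∫ x in unitCube n, f (torusMk x) :=
  integral_map continuous_torusMk.aemeasurable f.continuous.aestronglyMeasurable

theorem tendsto_empiricalMeasure_torusMk {n : ℕ} {P : Matrix (Fin n) (Fin n) ℝ}
    (hP : P ∈ Matrix.orthogonalGroup (Fin n) ℝ) (hirr : TotallyIrrational P) :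
    Tendsto (empiricalMeasure fun y => torusMk (P.transpose.mulVec (intVec y))) atTop
      (nhds (torusMeasure n)) := by
  refine tendsto_of_tendsto_integral_mFourier fun k => ?_
  by_cases hk : k = 0
  · subst hk
    simp [UnitAddTorus.mFourier_zero]
  · simp only [integral_torusMeasure, integral_mFourier_unitCube hk, integral_empiricalMeasure,
      mFourier_torusMk_transpose_mulVec]
    exact tendsto_average_exp (exists_mulVec_intVec_ne_intCast hP hirr hk)

theorem measurePreserving_mulVec_of_mem_orthogonalGroup {n : ℕ} {P : Matrix (Fin n) (Fin n) ℝ}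
    (hP : P ∈ Matrix.orthogonalGroup (Fin n) ℝ) :
    MeasurePreserving P.mulVec (volume : Measure (Fin n → ℝ)) volume := by
  have hPP : P * P.transpose = 1 := (Matrix.mem_orthogonalGroup_iff _ _).1 hP
  have hdet : P.det * P.det = 1 := by
    simpa [Matrix.det_mul, Matrix.det_transpose] using congrArg Matrix.det hPP
  have habs : |P.det| = 1 := by
    rcases mul_self_eq_one_iff.1 hdet with h | h <;> simp [h]
  refine ⟨(Continuous.matrix_mulVec continuous_const continuous_id).measurable, ?_⟩
  have := Real.map_matrix_volume_pi_eq_smul_volume_pi (M := P) (by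
    intro h
    simp [h] at hdet)
  rw [abs_inv, habs, inv_one, ENNReal.ofReal_one, one_smul] at this
  exact this

theorem measure_inter_eq_of_existsUnique {E : Type*} [AddCommGroup E] [MeasurableSpace E]
    [MeasurableAdd E] {μ : Measure E} [μ.IsAddLeftInvariant] {Λ : AddSubgroup E} [Countable Λ]
    {s t U : Set E}
    (hs : MeasurableSet s) (ht : MeasurableSet t) (hU : MeasurableSet U)
    (hsΛ : ∀ x, ∃! l, l ∈ Λ ∧ x - l ∈ s) (htΛ : ∀ x, ∃! l, l ∈ Λ ∧ x - l ∈ t)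
    (hUΛ : ∀ l ∈ Λ, ∀ x ∈ U, l + x ∈ U) : μ (U ∩ s) = μ (U ∩ t) := by
  have key : ∀ {s : Set E}, MeasurableSet s → (∀ x, ∃! l, l ∈ Λ ∧ x - l ∈ s) →
      IsAddFundamentalDomain Λ s μ := by
    intro s hs hsΛ
    refine IsAddFundamentalDomain.mk' hs.nullMeasurableSet fun x => ?_
    obtain ⟨l, ⟨hl, hls⟩, huniq⟩ := hsΛ x
    refine ⟨⟨-l, Λ.neg_mem hl⟩, ?_, ?_⟩
    · simpa [AddSubgroup.vadd_def, neg_add_eq_sub] using hls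
    · rintro ⟨m, hm⟩ hms
      have := huniq (-m) ⟨Λ.neg_mem hm, by simpa [AddSubgroup.vadd_def, add_comm] using hms⟩
      simp [← this]
  refine (key hs hsΛ).measure_set_eq (key ht htΛ) hU fun g => ?_
  ext x
  refine ⟨fun h => ?_, fun h => hUΛ g g.2 x h⟩
  simpa [AddSubgroup.vadd_def] using hUΛ (-g) (Λ.neg_mem g.2) _ h

/-- The lattice `P(ℤ^n)`. -/
def latticeOf {n : ℕ} (P : Matrix (Fin n) (Fin n) ℝ) : AddSubgroup (Fin n → ℝ) :=
  (P.mulVecLin.toAddMonoidHom.comp ((Int.castAddHom ℝ).compLeft (Fin n))).range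

theorem coe_latticeOf {n : ℕ} (P : Matrix (Fin n) (Fin n) ℝ) :
    (latticeOf P : Set (Fin n → ℝ)) = P.mulVec '' intPoints n := by
  rw [intPoints, ← Set.range_comp]
  rfl

instance {n : ℕ} (P : Matrix (Fin n) (Fin n) ℝ) : Countable (latticeOf P) :=
  (Set.countable_range _).to_subtype

theorem existsUnique_intPoints_sub_mem_unitCube {n : ℕ} (x : Fin n → ℝ) :
    ∃! l, l ∈ intPoints n ∧ x - l ∈ unitCube n := by
  refine ⟨intVec fun i => ⌊x i⌋, ⟨⟨_, rfl⟩, fun i _ => ?_⟩, ?_⟩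
  · simp only [intVec, Pi.sub_apply, Set.mem_Ico, sub_nonneg, sub_lt_iff_lt_add']
    exact ⟨Int.floor_le _, by linarith [Int.lt_floor_add_one (x i)]⟩
  · rintro _ ⟨⟨z, rfl⟩, hz⟩
    ext i
    have := hz i (Set.mem_univ i)
    simp only [intVec, Pi.sub_apply, Set.mem_Ico] at this ⊢
    rw [show ⌊x i⌋ = z i from Int.floor_eq_iff.2 ⟨by linarith, by linarith⟩]

section Orthogonal

variable {n : ℕ} {P : Matrix (Fin n) (Fin n) ℝ}

theorem transpose_mulVec_mulVec (hP : P ∈ Matrix.orthogonalGroup (Fin n) ℝ) (x : Fin n → ℝ) :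
    P.transpose.mulVec (P.mulVec x) = x := by
  rw [Matrix.mulVec_mulVec, (Matrix.mem_orthogonalGroup_iff' _ _).1 hP, Matrix.one_mulVec]

theorem mulVec_transpose_mulVec (hP : P ∈ Matrix.orthogonalGroup (Fin n) ℝ) (x : Fin n → ℝ) :
    P.mulVec (P.transpose.mulVec x) = x := by
  rw [Matrix.mulVec_mulVec, (Matrix.mem_orthogonalGroup_iff _ _).1 hP, Matrix.one_mulVec]

theorem transpose_mem_orthogonalGroup (hP : P ∈ Matrix.orthogonalGroup (Fin n) ℝ) :
    P.transpose ∈ Matrix.orthogonalGroup (Fin n) ℝ := by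
  rw [Matrix.mem_orthogonalGroup_iff, Matrix.transpose_transpose]
  exact (Matrix.mem_orthogonalGroup_iff' _ _).1 hP

theorem existsUnique_lattice_sub_mem_preimage (hP : P ∈ Matrix.orthogonalGroup (Fin n) ℝ)
    (x : Fin n → ℝ) :
    ∃! l, l ∈ P.mulVec '' intPoints n ∧ x - l ∈ P.transpose.mulVec ⁻¹' unitCube n := by
  obtain ⟨l, ⟨hl, hlx⟩, huniq⟩ := existsUnique_intPoints_sub_mem_unitCube (P.transpose.mulVec x)
  refine ⟨P.mulVec l, ⟨⟨l, hl, rfl⟩, ?_⟩, ?_⟩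
  · rwa [Set.mem_preimage, Matrix.mulVec_sub, transpose_mulVec_mulVec hP]
  · rintro _ ⟨⟨m, hm, rfl⟩, hmx⟩
    rw [Set.mem_preimage, Matrix.mulVec_sub, transpose_mulVec_mulVec hP] at hmx
    rw [huniq m ⟨hm, hmx⟩]

/-- The union of the open balls of radius `1/2` centred at the points of `P(ℤ^n)`. -/
def ballUnion (P : Matrix (Fin n) (Fin n) ℝ) : Set (Fin n → ℝ) :=
  ⋃ l ∈ P.mulVec '' intPoints n, Metric.ball l (1/2 : ℝ)

theorem isOpen_ballUnion : IsOpen (ballUnion P) :=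
  isOpen_biUnion fun _ _ => Metric.isOpen_ball

theorem add_mem_ballUnion {l x : Fin n → ℝ} (hl : l ∈ latticeOf P) (hx : x ∈ ballUnion P) :
    l + x ∈ ballUnion P := by
  simp only [ballUnion, ← coe_latticeOf, Set.mem_iUnion, SetLike.mem_coe] at hx ⊢
  obtain ⟨m, hm, hx⟩ := hx
  refine ⟨l + m, (latticeOf P).add_mem hl hm, ?_⟩
  simpa [Metric.mem_ball] using hx

theorem volume_ballUnion_inter (hP : P ∈ Matrix.orthogonalGroup (Fin n) ℝ)
    {𝒟 : Set (Fin n → ℝ)} (h𝒟 : MeasurableSet 𝒟)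
    (hfund : ∀ x : Fin n → ℝ, ∃! l : Fin n → ℝ, l ∈ P.mulVec '' intPoints n ∧ x - l ∈ 𝒟) :
    volume (ballUnion P ∩ 𝒟) = volume (P.mulVec ⁻¹' ballUnion P ∩ unitCube n) := by
  have hQ := measurePreserving_mulVec_of_mem_orthogonalGroup (transpose_mem_orthogonalGroup hP)
  have hmeas := hQ.measurable (measurableSet_unitCube n)
  rw [measure_inter_eq_of_existsUnique (Λ := latticeOf P) h𝒟 hmeas isOpen_ballUnion.measurableSet
    (by simpa only [← coe_latticeOf, SetLike.mem_coe] using hfund)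
    (by simpa only [← coe_latticeOf, SetLike.mem_coe] using existsUnique_lattice_sub_mem_preimage hP)
    (fun l hl x hx => add_mem_ballUnion hl hx),
    ← (measurePreserving_mulVec_of_mem_orthogonalGroup hP).measure_preimage
      (isOpen_ballUnion.measurableSet.inter hmeas).nullMeasurableSet]
  congr 1
  ext x
  simp [transpose_mulVec_mulVec hP]

/-- The image in the torus of the preimage of `S` under `P`. -/
def torusImage (P : Matrix (Fin n) (Fin n) ℝ) (S : Set (Fin n → ℝ)) : Set (UnitAddTorus (Fin n)) :=
  torusMk '' (P.mulVec ⁻¹' S)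

theorem torusMk_mem_torusImage_iff {S : Set (Fin n → ℝ)} {x : Fin n → ℝ} :
    torusMk x ∈ torusImage P S ↔ ∃ z : Fin n → ℤ, P.mulVec x - P.mulVec (intVec z) ∈ S := by
  constructor
  · rintro ⟨c, hc, hcx⟩
    obtain ⟨m, rfl⟩ := torusMk_eq_torusMk_iff.1 hcx.symm
    exact ⟨m, by simpa [Matrix.mulVec_add] using hc⟩
  · rintro ⟨z, hz⟩
    refine ⟨x - intVec z, by rwa [Set.mem_preimage, Matrix.mulVec_sub], ?_⟩
    exact torusMk_eq_torusMk_iff.2 ⟨-z, by ext; simp [intVec, sub_eq_add_neg]⟩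

theorem continuous_mulVec : Continuous P.mulVec :=
  Continuous.matrix_mulVec continuous_const continuous_id

theorem isOpen_torusImage {S : Set (Fin n → ℝ)} (hS : IsOpen S) : IsOpen (torusImage P S) :=
  isOpenMap_torusMk _ (hS.preimage continuous_mulVec)

theorem isCompact_torusImage (hP : P ∈ Matrix.orthogonalGroup (Fin n) ℝ) {S : Set (Fin n → ℝ)}
    (hS : IsCompact S) : IsCompact (torusImage P S) := by
  have : P.mulVec ⁻¹' S = P.transpose.mulVec '' S :=
    (Set.image_eq_preimage_of_inverse (mulVec_transpose_mulVec hP)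
      (transpose_mulVec_mulVec hP) ▸ rfl)
  rw [torusImage, this]
  exact (hS.image continuous_mulVec).image continuous_torusMk

theorem torusImage_mono {S T : Set (Fin n → ℝ)} (h : S ⊆ T) : torusImage P S ⊆ torusImage P T :=
  Set.image_mono (Set.preimage_mono h)

theorem torusMeasure_torusImage_ball :
    (torusMeasure n : Measure (UnitAddTorus (Fin n))) (torusImage P (Metric.ball 0 (1/2))) =
      volume (P.mulVec ⁻¹' ballUnion P ∩ unitCube n) := by
  rw [torusMeasure, ProbabilityMeasure.coe_mk, Measure.map_apply continuous_torusMk.measurable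
    (isOpen_torusImage Metric.isOpen_ball).measurableSet,
    Measure.restrict_apply ((isOpen_torusImage Metric.isOpen_ball).preimage
      continuous_torusMk).measurableSet]
  congr 2
  ext x
  simp only [Set.mem_preimage, torusMk_mem_torusImage_iff, ballUnion, intPoints, Set.mem_iUnion,
    Set.mem_image, Set.mem_range, exists_prop, exists_exists_eq_and, Metric.mem_ball,
    dist_eq_norm, sub_zero]

theorem torusMeasure_torusImage_eq_zero (hP : P ∈ Matrix.orthogonalGroup (Fin n) ℝ)
    {S : Set (Fin n → ℝ)} (hS : IsCompact S) (hS0 : volume S = 0) :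
    (torusMeasure n : Measure (UnitAddTorus (Fin n))) (torusImage P S) = 0 := by
  rw [torusMeasure, ProbabilityMeasure.coe_mk, Measure.map_apply continuous_torusMk.measurable
    (isCompact_torusImage hP hS).measurableSet]
  refine Measure.absolutelyContinuous_of_le Measure.restrict_le_self ?_
  have hsub : torusMk ⁻¹' torusImage P S ⊆
      ⋃ z : Fin n → ℤ, P.mulVec ⁻¹' ((· - P.mulVec (intVec z)) ⁻¹' S) := by
    intro x hx
    simpa [torusMk_mem_torusImage_iff] using hx
  refine measure_mono_null hsub (measure_iUnion_null fun z => ?_)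
  have hm : MeasurableSet ((· - P.mulVec (intVec z)) ⁻¹' S) :=
    (hS.isClosed.preimage (continuous_id.sub continuous_const)).measurableSet
  rw [(measurePreserving_mulVec_of_mem_orthogonalGroup hP).measure_preimage hm.nullMeasurableSet,
    (measurePreserving_sub_right volume _).measure_preimage hS.isClosed.nullMeasurableSet]
  exact hS0

/-- The half-open cube `[-1/2,1/2)^n`. -/
def halfCube (n : ℕ) : Set (Fin n → ℝ) := Set.pi Set.univ fun _ => Set.Ico (-(1/2) : ℝ) (1/2)

theorem ball_subset_halfCube : Metric.ball (0 : Fin n → ℝ) (1/2) ⊆ halfCube n := by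
  intro x hx i _
  have := (pi_norm_lt_iff (by norm_num)).1 (mem_ball_zero_iff.1 hx) i
  rw [Real.norm_eq_abs, abs_lt] at this
  exact ⟨this.1.le, this.2⟩

theorem halfCube_subset_closedBall : halfCube n ⊆ Metric.closedBall (0 : Fin n → ℝ) (1/2) := by
  intro x hx
  rw [mem_closedBall_zero_iff, pi_norm_le_iff_of_nonneg (by norm_num)]
  intro i
  have := hx i (Set.mem_univ i)
  rw [Real.norm_eq_abs, abs_le]
  exact ⟨this.1, this.2.le⟩

theorem torusImage_closedBall_diff_subset :
    torusImage P (Metric.closedBall 0 (1/2)) \ torusImage P (Metric.ball 0 (1/2)) ⊆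
      torusImage P (Metric.sphere 0 (1/2)) := by
  rintro _ ⟨⟨x, hx, rfl⟩, hx'⟩
  refine ⟨x, ?_, rfl⟩
  rw [Set.mem_preimage, ← Metric.closedBall_sdiff_ball]
  exact ⟨hx, fun h => hx' ⟨x, h, rfl⟩⟩

theorem torusMeasure_sphere (hP : P ∈ Matrix.orthogonalGroup (Fin n) ℝ) :
    (torusMeasure n : Measure (UnitAddTorus (Fin n))) (torusImage P (Metric.sphere 0 (1/2))) = 0 :=
  torusMeasure_torusImage_eq_zero hP (isCompact_sphere _ _)
    (Measure.addHaar_sphere_of_ne_zero _ _ (by norm_num))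

theorem torusMeasure_frontier_halfCube (hP : P ∈ Matrix.orthogonalGroup (Fin n) ℝ) :
    (torusMeasure n : Measure (UnitAddTorus (Fin n))) (frontier (torusImage P (halfCube n))) =
      0 := by
  refine measure_mono_null ?_ (torusMeasure_sphere hP)
  refine (Set.sdiff_subset_sdiff ?_ ?_).trans torusImage_closedBall_diff_subset
  · exact closure_minimal (torusImage_mono halfCube_subset_closedBall)
      (isCompact_torusImage hP (isCompact_closedBall _ _)).isClosed
  · exact interior_maximal (torusImage_mono ball_subset_halfCube)
      (isOpen_torusImage Metric.isOpen_ball)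

theorem torusMeasure_torusImage_halfCube (hP : P ∈ Matrix.orthogonalGroup (Fin n) ℝ) :
    (torusMeasure n : Measure (UnitAddTorus (Fin n))) (torusImage P (halfCube n)) =
      volume (P.mulVec ⁻¹' ballUnion P ∩ unitCube n) := by
  rw [← torusMeasure_torusImage_ball]
  refine le_antisymm ?_ (measure_mono (torusImage_mono ball_subset_halfCube))
  refine (measure_mono (t := torusImage P (Metric.ball 0 (1/2)) ∪
    torusImage P (Metric.sphere 0 (1/2))) ?_).trans ?_
  · intro x hx
    by_cases h : x ∈ torusImage P (Metric.ball 0 (1/2))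
    · exact Or.inl h
    · exact Or.inr (torusImage_closedBall_diff_subset
        ⟨torusImage_mono halfCube_subset_closedBall hx, h⟩)
  · refine (measure_union_le _ _).trans ?_
    rw [torusMeasure_sphere hP, add_zero]

end Orthogonal

theorem intVec_injective {n : ℕ} : Function.Injective (intVec (n := n)) := by
  intro a b h
  ext i
  exact Int.cast_injective (α := ℝ) (congrFun h i)

theorem intVec_mem_ball_iff {n : ℕ} {R : ℝ} (hR : 0 < R) {y : Fin n → ℤ} :
    intVec y ∈ Metric.ball (0 : Fin n → ℝ) R ↔ y ∈ intBox n (⌈R⌉₊ - 1) := by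
  have hc : 0 < ⌈R⌉₊ := Nat.ceil_pos.2 hR
  simp only [mem_ball_zero_iff, pi_norm_lt_iff hR, intBox, Fintype.mem_piFinset, Finset.mem_Icc]
  refine forall_congr' fun i => ?_
  have : ‖intVec y i‖ = ((y i).natAbs : ℝ) := by
    rw [intVec, Real.norm_eq_abs, ← Int.cast_abs, Int.abs_eq_natAbs, Int.cast_natCast]
  rw [this, ← Nat.lt_ceil]
  omega

theorem intVec_mem_PhatImg_iff {n : ℕ} {P : Matrix (Fin n) (Fin n) ℝ}
    (hP : P ∈ Matrix.orthogonalGroup (Fin n) ℝ) {y : Fin n → ℤ} :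
    intVec y ∈ PhatImg P (intPoints n) ↔
      torusMk (P.transpose.mulVec (intVec y)) ∈ torusImage P (halfCube n) := by
  rw [torusMk_mem_torusImage_iff, mulVec_transpose_mulVec hP, PhatImg, intPoints,
    ← Set.range_comp, Set.mem_range]
  refine exists_congr fun z => ?_
  simp only [Function.comp_apply, discretizeR, intVec_injective.eq_iff, funext_iff, discretize,
    roundHalf, halfCube, Set.mem_univ_pi, Set.mem_Ico, Pi.sub_apply, Int.ceil_eq_iff]
  refine forall_congr' fun i => ?_
  simp only [intVec]
  constructor <;> rintro ⟨h1, h2⟩ <;> constructor <;> linarith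

theorem injectivity_ratio_eq {n : ℕ} {P : Matrix (Fin n) (Fin n) ℝ}
    (hP : P ∈ Matrix.orthogonalGroup (Fin n) ℝ) {R : ℝ} (hR : 0 < R) :
    ((PhatImg P (intPoints n) ∩ Metric.ball (0 : Fin n → ℝ) R).ncard : ℝ) /
      ((intPoints n ∩ Metric.ball (0 : Fin n → ℝ) R).ncard : ℝ) =
    ((empiricalMeasure (fun y => torusMk (P.transpose.mulVec (intVec y))) (⌈R⌉₊ - 1) :
      Measure (UnitAddTorus (Fin n))) (torusImage P (halfCube n))).toReal := by
  classical
  have h1 : intPoints n ∩ Metric.ball (0 : Fin n → ℝ) R = intVec '' (intBox n (⌈R⌉₊ - 1) : Set _) := by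
    ext x
    constructor
    · rintro ⟨⟨y, rfl⟩, hy⟩
      exact ⟨y, (intVec_mem_ball_iff hR).1 hy, rfl⟩
    · rintro ⟨y, hy, rfl⟩
      exact ⟨⟨y, rfl⟩, (intVec_mem_ball_iff hR).2 hy⟩
  have h2 : PhatImg P (intPoints n) ∩ Metric.ball (0 : Fin n → ℝ) R =
      intVec '' (((intBox n (⌈R⌉₊ - 1)).filter fun y =>
        torusMk (P.transpose.mulVec (intVec y)) ∈ torusImage P (halfCube n) :
          Finset (Fin n → ℤ)) : Set (Fin n → ℤ)) := by
    ext x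
    simp only [Finset.coe_filter]
    constructor
    · rintro ⟨hx, hxR⟩
      obtain ⟨y, rfl⟩ : ∃ y, intVec y = x := by
        obtain ⟨z, -, hz⟩ := hx
        exact ⟨_, hz⟩
      exact ⟨y, ⟨(intVec_mem_ball_iff hR).1 hxR, (intVec_mem_PhatImg_iff hP).1 hx⟩, rfl⟩
    · rintro ⟨y, ⟨hyR, hy⟩, rfl⟩
      exact ⟨(intVec_mem_PhatImg_iff hP).2 hy, (intVec_mem_ball_iff hR).2 hyR⟩
  rw [h1, h2, Set.ncard_image_of_injective _ intVec_injective,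
    Set.ncard_image_of_injective _ intVec_injective, Set.ncard_coe_finset, Set.ncard_coe_finset,
    empiricalMeasure_apply_toReal]

/-- For a totally irrational isometry `P`, with `Λ = P(ℤ^n)` and
`U = ⋃_{λ ∈ Λ} B(λ, 1/2)`, the rate of injectivity in time 1 equals `Leb(U ∩ 𝒟)` for any
fundamental domain `𝒟` of the lattice `Λ`. -/
theorem statement7 {n : ℕ} (P : Matrix (Fin n) (Fin n) ℝ)
    (hP : P ∈ Matrix.orthogonalGroup (Fin n) ℝ) (hirr : TotallyIrrational P)
    (𝒟 : Set (Fin n → ℝ)) (h𝒟 : MeasurableSet 𝒟)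
    (hfund : ∀ x : Fin n → ℝ, ∃! l : Fin n → ℝ, l ∈ P.mulVec '' intPoints n ∧ x - l ∈ 𝒟) :
    tauOne P =
      (MeasureTheory.volume
        ((⋃ l ∈ P.mulVec '' intPoints n, Metric.ball l (1/2 : ℝ)) ∩ 𝒟)).toReal := by
  have hlim := ProbabilityMeasure.tendsto_measure_of_null_frontier_of_tendsto'
    (tendsto_empiricalMeasure_torusMk hP hirr) (torusMeasure_frontier_halfCube hP)
  rw [torusMeasure_torusImage_halfCube hP, ← volume_ballUnion_inter hP h𝒟 hfund] at hlim
  have hfin : volume (ballUnion P ∩ 𝒟) ≠ ⊤ := by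
    rw [volume_ballUnion_inter hP h𝒟 hfund]
    exact ((measure_mono Set.inter_subset_right).trans_lt
      ((volume_unitCube n).trans_lt ENNReal.one_lt_top)).ne
  have hceil : Tendsto (fun R : ℝ => ⌈R⌉₊ - 1) atTop atTop :=
    (tendsto_sub_atTop_nat 1).comp tendsto_nat_ceil_atTop
  refine Tendsto.limsup_eq ((((ENNReal.tendsto_toReal hfin).comp hlim).comp hceil).congr' ?_)
  filter_upwards [eventually_gt_atTop 0] with R hR
  exact (injectivity_ratio_eq hP hR).symm

end
end
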